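/- Let X₁, …, X_{2d} ⊆ S^{d-1} with pos X_i = ℝ^d for all i ∈ [2d], and suppose no partial transversal over a proper subset of [2d] has conic hull equal to ℝ^d. Then either (BCase) there is a basis e₁,…,e_d of ℝ^d with ‖e_i‖ = 1 such that X_i = {±e₁,…,±e_d} for every i ∈ [2d], or (PCase) there is a set F ⊆ S^{d-1} of d+1 vectors forming a positive basis of ℝ^d such that, after a permutation of the indices, d of the sets X_i equal F and the other d equal −F. -/

import Mathlib

open scoped BigOperators

/-- The positive (conic) hull of a set: all finite nonnegative linear combinations. -/
def posHull {d : ℕ} (A : Set (EuclideanSpace ℝ (Fin d))) : Set (EuclideanSpace ℝ (Fin d)) :=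
  {x | ∃ (n : ℕ) (c : Fin n → ℝ) (f : Fin n → EuclideanSpace ℝ (Fin d)),
    (∀ i, 0 ≤ c i) ∧ (∀ i, f i ∈ A) ∧ x = ∑ i, c i • f i}

namespace CS

lemma ph_zero {d : ℕ} (A : Set (EuclideanSpace ℝ (Fin d))) : (0 : EuclideanSpace ℝ (Fin d)) ∈ posHull A :=
  ⟨0, Fin.elim0, Fin.elim0, fun i => i.elim0, fun i => i.elim0, by simp⟩

lemma ph_mem {d : ℕ} {A : Set (EuclideanSpace ℝ (Fin d))} {x : EuclideanSpace ℝ (Fin d)} (h : x ∈ A) :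
    x ∈ posHull A :=
  ⟨1, fun _ => 1, fun _ => x, fun _ => zero_le_one, fun _ => h, by simp⟩

lemma ph_smul {d : ℕ} {A : Set (EuclideanSpace ℝ (Fin d))} {x : EuclideanSpace ℝ (Fin d)} {r : ℝ}
    (hr : 0 ≤ r) (h : x ∈ posHull A) : r • x ∈ posHull A := by
  obtain ⟨n, c, f, hc, hf, rfl⟩ := h
  exact ⟨n, fun i => r * c i, f, fun i => mul_nonneg hr (hc i), hf, by
    simp [Finset.smul_sum, smul_smul]⟩

lemma ph_add {d : ℕ} {A : Set (EuclideanSpace ℝ (Fin d))} {x y : EuclideanSpace ℝ (Fin d)}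
    (hx : x ∈ posHull A) (hy : y ∈ posHull A) : x + y ∈ posHull A := by
  obtain ⟨n, c, f, hc, hf, rfl⟩ := hx
  obtain ⟨m, c', f', hc', hf', rfl⟩ := hy
  refine ⟨n + m, Fin.append c c', Fin.append f f', ?_, ?_, ?_⟩
  · intro i; refine Fin.addCases (fun i => ?_) (fun i => ?_) i <;> simp [hc, hc']
  · intro i; refine Fin.addCases (fun i => ?_) (fun i => ?_) i <;> simp [hf, hf']
  · simp [Fin.sum_univ_add]

lemma ph_sum {d : ℕ} {A : Set (EuclideanSpace ℝ (Fin d))} {ι : Type*} (s : Finset ι)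
    (x : ι → EuclideanSpace ℝ (Fin d)) (h : ∀ i ∈ s, x i ∈ posHull A) : ∑ i ∈ s, x i ∈ posHull A := by
  classical
  induction s using Finset.induction_on with
  | empty => simpa using ph_zero A
  | insert a s ha ih =>
    rw [Finset.sum_insert ha]
    exact ph_add (h _ (by simp)) (ih fun i hi => h i (by simp [hi]))

lemma ph_pos {d : ℕ} {A : Set (EuclideanSpace ℝ (Fin d))} {v : EuclideanSpace ℝ (Fin d)}
    (h : v ∈ posHull A) (φ : EuclideanSpace ℝ (Fin d) →ₗ[ℝ] ℝ) (hφ : 0 < φ v) : ∃ a ∈ A, 0 < φ a := by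
  obtain ⟨n, c, f, hc, hf, rfl⟩ := h
  by_contra! hcon
  rw [map_sum] at hφ
  refine absurd hφ (not_lt.2 (Finset.sum_nonpos fun i _ => ?_))
  rw [map_smul, smul_eq_mul]
  exact mul_nonpos_of_nonneg_of_nonpos (hc i) (hcon _ (hf i))

lemma ph_univ_pos {d : ℕ} {A : Set (EuclideanSpace ℝ (Fin d))} 
    (h : posHull A = Set.univ) (φ : EuclideanSpace ℝ (Fin d) →ₗ[ℝ] ℝ) (hφ : φ ≠ 0) : ∃ a ∈ A, 0 < φ a := by
  obtain ⟨v, hv⟩ : ∃ v, φ v ≠ 0 := by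
    by_contra! hc
    exact hφ (LinearMap.ext hc)
  rcases lt_or_gt_of_ne hv with h1 | h1
  · exact ph_pos (v := -v) (by rw [h]; trivial) φ (by rw [map_neg]; linarith)
  · exact ph_pos (v := v) (by rw [h]; trivial) φ h1

lemma ph_span {d : ℕ} {A : Set (EuclideanSpace ℝ (Fin d))} (h : posHull A = Set.univ) :
    Submodule.span ℝ A = ⊤ := by
  rw [eq_top_iff]
  intro v _
  have : v ∈ posHull A := by rw [h]; trivial
  obtain ⟨n, c, f, hc, hf, rfl⟩ := this
  exact Submodule.sum_mem _ fun i _ => Submodule.smul_mem _ _ (Submodule.subset_span (hf i))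

/-- Ratio test: for `c ≥ 0` and `g` with some positive coordinate, one can subtract a multiple of
`g` staying nonnegative and killing one of the coordinates where `g` is positive. -/
lemma ratio {ι : Type*} [Fintype ι] (c g : ι → ℝ) (hc : ∀ i, 0 ≤ c i) (hg : ∃ i, 0 < g i) :
    ∃ s : ℝ, 0 ≤ s ∧ (∀ i, 0 ≤ c i - s * g i) ∧ ∃ i, 0 < g i ∧ c i - s * g i = 0 := by
  classical
  obtain ⟨i0, hi0⟩ := hg
  obtain ⟨i, hi, hmin⟩ := Finset.exists_min_image (Finset.univ.filter fun i => 0 < g i)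
    (fun i => c i / g i) ⟨i0, by simpa using hi0⟩
  simp only [Finset.mem_filter, Finset.mem_univ, true_and] at hi hmin
  refine ⟨c i / g i, div_nonneg (hc i) hi.le, fun j => ?_, i, hi, ?_⟩
  · have h0 : 0 ≤ c i / g i := div_nonneg (hc i) hi.le
    rcases lt_or_ge 0 (g j) with hj | hj
    · have := hmin j hj
      rw [le_div_iff₀ hj] at this
      linarith
    · have := mul_nonpos_of_nonneg_of_nonpos h0 hj
      linarith [hc j]
  · field_simp
    simp

lemma conicCar {ι V : Type*} [Fintype ι] [AddCommGroup V] [Module ℝ V] (y : ι → V) (c : ι → ℝ)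
    (hc : ∀ i, 0 ≤ c i) :
    ∃ c' : ι → ℝ, (∀ i, 0 ≤ c' i) ∧ ∑ i, c' i • y i = ∑ i, c i • y i ∧
      ∀ g : ι → ℝ, (∀ i, c' i = 0 → g i = 0) → ∑ i, g i • y i = 0 → g = 0 := by
  classical
  let P : ℕ → Prop := fun N => ∃ c' : ι → ℝ, (∀ i, 0 ≤ c' i) ∧ ∑ i, c' i • y i = ∑ i, c i • y i ∧
    (Finset.univ.filter fun i => c' i ≠ 0).card = N
  have hP : ∃ N, P N := ⟨_, c, hc, rfl, rfl⟩
  obtain ⟨c', h0, hs, hcard⟩ := Nat.find_spec hP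
  refine ⟨c', h0, hs, ?_⟩
  have key : ∀ g : ι → ℝ, (∀ i, c' i = 0 → g i = 0) → ∑ i, g i • y i = 0 → ¬ ∃ i, 0 < g i := by
    intro g hg hsum hpos
    obtain ⟨s, hs0, hnn, i, hi, hzero⟩ := ratio c' g h0 hpos
    refine Nat.find_min hP (m := (Finset.univ.filter fun i => c' i - s * g i ≠ 0).card) ?_
      ⟨fun i => c' i - s * g i, hnn, ?_, rfl⟩
    · rw [← hcard]
      apply Finset.card_lt_card
      rw [Finset.ssubset_iff_of_subset]
      · refine ⟨i, ?_, ?_⟩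
        · simp only [Finset.mem_filter, Finset.mem_univ, true_and]
          intro h; have := hg i h; linarith
        · simp [hzero]
      · intro j
        simp only [Finset.mem_filter, Finset.mem_univ, true_and]
        intro hj h; apply hj; rw [h, hg j h]; simp
    · simp only [sub_smul, mul_smul, Finset.sum_sub_distrib, ← Finset.smul_sum, hsum, hs]
      simp
  intro g hg hsum
  funext i
  have h1 := key g hg hsum
  have h2 := key (fun i => - g i) (fun i hi => by simp [hg i hi]) (by simp [hsum])
  push Not at h1 h2
  have := h1 i
  have := h2 i
  simp only [Pi.zero_apply]
  linarith

lemma cone_closed {n : ℕ} {d : ℕ} (y : Fin n → EuclideanSpace ℝ (Fin d)) :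
    IsClosed {p : EuclideanSpace ℝ (Fin d) | ∃ c : Fin n → ℝ, (∀ i, 0 ≤ c i) ∧ p = ∑ i, c i • y i} := by
  classical
  let L : (Fin n → ℝ) →ₗ[ℝ] EuclideanSpace ℝ (Fin d) := Fintype.linearCombination ℝ y
  have hL : ∀ c, L c = ∑ i, c i • y i := fun c => Fintype.linearCombination_apply ℝ y c
  let P : Finset (Fin n) → Submodule ℝ (Fin n → ℝ) := fun S =>
    { carrier := {c | ∀ i ∉ S, c i = 0}
      add_mem' := by intro a b ha hb i hi; simp [ha i hi, hb i hi]
      zero_mem' := by intro i _; rfl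
      smul_mem' := by intro r a ha i hi; simp [ha i hi] }
  let good : Set (Finset (Fin n)) := {S | ∀ g ∈ P S, L g = 0 → g = 0}
  have heq : {p : EuclideanSpace ℝ (Fin d) | ∃ c : Fin n → ℝ, (∀ i, 0 ≤ c i) ∧ p = ∑ i, c i • y i} =
      ⋃ S ∈ good, (L.domRestrict (P S)) '' {c : P S | ∀ i, 0 ≤ (c : Fin n → ℝ) i} := by
    ext p
    simp only [Set.mem_ofPred_eq, Set.mem_iUnion, Set.mem_image]
    constructor
    · rintro ⟨c, hc, rfl⟩
      obtain ⟨c', h0, hs, hind⟩ := conicCar y c hc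
      refine ⟨Finset.univ.filter fun i => c' i ≠ 0, ?_, ⟨c', ?_⟩, h0, ?_⟩
      · intro g hg hg0
        refine hind g (fun i hi => hg i (by simp [hi])) (by rw [← hL]; exact hg0)
      · intro i hi; simpa using hi
      · rw [LinearMap.domRestrict_apply, hL, hs]
    · rintro ⟨S, hS, c, hc, rfl⟩
      exact ⟨c, hc, by rw [LinearMap.domRestrict_apply, hL]⟩
  rw [heq]
  refine (Set.toFinite good).isClosed_biUnion fun S hS => ?_
  refine (LinearMap.isClosedEmbedding_of_injective (f := L.domRestrict (P S)) ?_).isClosedMap _ ?_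
  · rw [LinearMap.ker_eq_bot']
    intro g hg
    exact Subtype.ext (hS g.1 g.2 hg)
  · simp only [Set.ofPred_forall]
    refine isClosed_iInter fun i => ?_
    exact isClosed_le continuous_const ((continuous_apply i).comp continuous_subtype_val)

lemma opt {d : ℕ} (w q : EuclideanSpace ℝ (Fin d)) (t0 : ℝ) (ht0 : 0 < t0)
    (h : ∀ t, 0 ≤ t → t ≤ t0 → ‖w‖ ≤ ‖w - t • q‖) : inner ℝ w q ≤ 0 := by
  by_contra! hc
  set a := inner ℝ w q with ha
  have hq : 0 ≤ ‖q‖ ^ 2 := by positivity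
  let t := min t0 (a / (‖q‖ ^ 2 + 1))
  have ht : 0 < t := lt_min ht0 (by positivity)
  have h1 := h t ht.le (min_le_left _ _)
  have h2 : ‖w - t • q‖ ^ 2 = ‖w‖ ^ 2 - 2 * (t * a) + t ^ 2 * ‖q‖ ^ 2 := by
    rw [norm_sub_sq_real, inner_smul_right, norm_smul, mul_pow]
    simp [ha]
  have h3 : ‖w‖ ^ 2 ≤ ‖w - t • q‖ ^ 2 := by gcongr
  have h4 : t ≤ a / (‖q‖ ^ 2 + 1) := min_le_right _ _
  rw [le_div_iff₀ (by positivity)] at h4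
  nlinarith

lemma finite_sub {d : ℕ} {A : Set (EuclideanSpace ℝ (Fin d))} {v : EuclideanSpace ℝ (Fin d)}
    (hne : A.Nonempty) (h : v ∈ posHull A) : ∃ B : Finset (EuclideanSpace ℝ (Fin d)),
      B.Nonempty ∧ (∀ b ∈ B, b ∈ A) ∧ ∀ w, 0 < inner ℝ w v → ∃ b ∈ B, 0 < inner ℝ w b := by
  classical
  obtain ⟨a, ha⟩ := hne
  obtain ⟨n, c, f, hc, hf, rfl⟩ := h
  refine ⟨insert a (Finset.univ.image f), by simp, ?_, ?_⟩
  · intro b hb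
    simp only [Finset.mem_insert, Finset.mem_image, Finset.mem_univ, true_and] at hb
    rcases hb with rfl | ⟨i, rfl⟩
    · exact ha
    · exact hf i
  · intro w hw
    have : (∑ i, c i • f i) ∈ posHull (Set.range f) := ⟨n, c, f, hc, fun i => ⟨i, rfl⟩, rfl⟩
    obtain ⟨b, ⟨i, rfl⟩, hb⟩ := ph_pos this (innerₗ _ w) (by rw [innerₗ_apply_apply]; exact hw)
    exact ⟨f i, by simp, by simpa using hb⟩

/-- Conic colourful Carathéodory. -/
lemma CC {n : ℕ} (Y : Fin n → Set (EuclideanSpace ℝ (Fin n))) (v : EuclideanSpace ℝ (Fin n))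
    (hne : ∀ i, (Y i).Nonempty) (hv : ∀ i, v ∈ posHull (Y i)) :
    ∃ (y : Fin n → EuclideanSpace ℝ (Fin n)) (c : Fin n → ℝ), (∀ i, y i ∈ Y i) ∧ (∀ i, 0 ≤ c i) ∧
      v = ∑ i, c i • y i := by
  classical
  choose B hBne hBY hB using fun i => finite_sub (hne i) (hv i)
  let cone : (Fin n → EuclideanSpace ℝ (Fin n)) → Set (EuclideanSpace ℝ (Fin n)) :=
    fun y => {p | ∃ c : Fin n → ℝ, (∀ i, 0 ≤ c i) ∧ p = ∑ i, c i • y i}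
  let Z : Set (EuclideanSpace ℝ (Fin n)) := ⋃ y ∈ Fintype.piFinset B, cone y
  have hZc : IsClosed Z := isClosed_biUnion_finset fun y _ => cone_closed y
  have hZm : ∀ p, p ∈ Z ↔ ∃ y : Fin n → EuclideanSpace ℝ (Fin n), (∀ i, y i ∈ B i) ∧ ∃ c : Fin n → ℝ, (∀ i, 0 ≤ c i) ∧ p = ∑ i, c i • y i := by
    intro p; simp [Z, cone, Fintype.mem_piFinset]
  have hZne : Z.Nonempty := by
    choose y hy using hBne
    exact ⟨0, (hZm 0).2 ⟨y, hy, 0, by simp, by simp⟩⟩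
  obtain ⟨p, hp, hmin⟩ := hZc.exists_infDist_eq_dist hZne v
  have hopt : ∀ (q : EuclideanSpace ℝ (Fin n)) (t0 : ℝ), 0 < t0 → (∀ t : ℝ, 0 ≤ t → t ≤ t0 → p + t • q ∈ Z) → inner ℝ (v - p) q ≤ 0 := by
    intro q t0 ht0 h
    refine opt _ _ t0 ht0 fun t h1 h2 => ?_
    have := Metric.infDist_le_dist_of_mem (x := v) (h t h1 h2)
    rw [hmin, dist_eq_norm, dist_eq_norm] at this
    rwa [sub_sub]
  obtain ⟨y, hy, c0, hc0, hpc0⟩ := (hZm p).1 hp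
  obtain ⟨c, hc, hcs, hind⟩ := conicCar y c0 hc0
  have hpc : p = ∑ i, c i • y i := hpc0.trans hcs.symm
  have hvp : v - p = 0 := by
    by_cases hall : ∀ i, c i ≠ 0
    · have hli : LinearIndependent ℝ y := by
        rw [Fintype.linearIndependent_iff]
        intro g hg
        exact congrFun (hind g (fun i hi => absurd hi (hall i)) hg)
      have hspan : Submodule.span ℝ (Set.range y) = ⊤ := hli.span_eq_top_of_card_eq_finrank' (by simp)
      have hadd : ∀ i, ∀ t : ℝ, 0 ≤ c i + t → p + t • y i ∈ Z := by
        intro i t ht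
        refine (hZm _).2 ⟨y, hy, c + Pi.single i t, ?_, ?_⟩
        · intro j
          by_cases hj : j = i
          · subst hj; simpa using ht
          · simpa [hj] using hc j
        · simp [add_smul, Finset.sum_add_distrib, hpc, Pi.single_apply, ite_smul]
      have horth : ∀ i, inner ℝ (v - p) (y i) = 0 := by
        intro i
        apply le_antisymm
        · exact hopt (y i) 1 one_pos fun t h1 _ => hadd i t (add_nonneg (hc i) h1)
        · have := hopt (-(y i)) (c i) (lt_of_le_of_ne (hc i) (hall i).symm) fun t h1 h2 => by
            rw [smul_neg, ← neg_smul]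
            exact hadd i (-t) (by linarith)
          rw [inner_neg_right] at this
          linarith
      have : ∀ z, innerₗ _ (v - p) z = (0 : EuclideanSpace ℝ (Fin n) →ₗ[ℝ] ℝ) z := by
        intro z
        refine LinearMap.eqOn_span (s := Set.range y) ?_ (by rw [hspan]; trivial)
        rintro _ ⟨i, rfl⟩
        rw [innerₗ_apply_apply]
        exact horth i
      have := this (v - p)
      rw [innerₗ_apply_apply] at this
      exact inner_self_eq_zero.1 this
    · push Not at hall
      obtain ⟨i, hi⟩ := hall
      have h1 : ¬ 0 < inner ℝ (v - p) v := by
        intro h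
        obtain ⟨b, hb, hpos⟩ := hB i _ h
        refine absurd hpos (not_lt.2 (hopt b 1 one_pos fun t ht _ => ?_))
        refine (hZm _).2 ⟨Function.update y i b, ?_, Function.update c i t, ?_, ?_⟩
        · intro j
          by_cases hj : j = i
          · subst hj; simpa using hb
          · simpa [hj] using hy j
        · intro j
          by_cases hj : j = i
          · subst hj; simpa using ht
          · simpa [hj] using hc j
        · rw [hpc, ← Finset.add_sum_erase _ _ (Finset.mem_univ i),
            ← Finset.add_sum_erase (a := i) _ (fun j => Function.update c i t j • Function.update y i b j) (Finset.mem_univ i)]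
          simp only [hi, zero_smul, zero_add, Function.update_self]
          rw [add_comm]
          congr 1
          refine Finset.sum_congr rfl fun j hj => ?_
          have := Finset.ne_of_mem_erase hj
          simp [this]
      have h2 := hopt (-p) 1 one_pos fun t ht ht1 => by
        refine (hZm _).2 ⟨y, hy, fun i => (1 - t) * c i, fun i => mul_nonneg (by linarith) (hc i), ?_⟩
        simp only [mul_smul, ← Finset.smul_sum, ← hpc]
        module
      rw [inner_neg_right] at h2
      have h3 : inner ℝ (v - p) (v - p) ≤ 0 := by
        rw [inner_sub_right (𝕜 := ℝ) (v - p) v p]; linarith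
      rw [real_inner_self_eq_norm_sq] at h3
      have : ‖v - p‖ = 0 := by
        have := sq_nonneg ‖v - p‖
        exact pow_eq_zero_iff (two_ne_zero) |>.1 (le_antisymm h3 this)
      exact norm_eq_zero.1 this
  refine ⟨y, c, fun i => hBY i _ (hy i), hc, ?_⟩
  rw [← hpc]
  exact sub_eq_zero.1 hvp

/-- Greedy choice of a linearly independent transversal. -/
lemma greedy {n m : ℕ} (hm : m ≤ n) (Y : Fin m → Set (EuclideanSpace ℝ (Fin n)))
    (hY : ∀ i, posHull (Y i) = Set.univ) :
    ∃ y : Fin m → EuclideanSpace ℝ (Fin n), (∀ i, y i ∈ Y i) ∧ LinearIndependent ℝ y := by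
  induction m with
  | zero => exact ⟨Fin.elim0, fun i => i.elim0, linearIndependent_empty_type⟩
  | succ m ih =>
    obtain ⟨y, hy, hli⟩ := ih (by omega) (fun i => Y i.castSucc) (fun i => hY _)
    obtain ⟨z, hz, hzs⟩ : ∃ z ∈ Y (Fin.last m), z ∉ Submodule.span ℝ (Set.range y) := by
      by_contra! hcon
      have h1 : Submodule.span ℝ (Set.range y) = ⊤ := by
        rw [eq_top_iff, ← ph_span (hY (Fin.last m))]
        exact Submodule.span_le.2 hcon
      have h2 := finrank_span_eq_card hli
      rw [h1, finrank_top] at h2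
      simp at h2
      omega
    refine ⟨Fin.snoc y z, ?_, ?_⟩
    · intro i
      refine Fin.lastCases ?_ (fun i => ?_) i
      · simpa using hz
      · simpa using hy i
    · rw [linearIndependent_finSnoc]
      exact ⟨hli, hzs⟩

lemma ph_univ_of_basis {n : ℕ} {A : Set (EuclideanSpace ℝ (Fin n))} (x : Fin n → EuclideanSpace ℝ (Fin n))
    (hx : Submodule.span ℝ (Set.range x) = ⊤) (h1 : ∀ i, x i ∈ posHull A) (r : Fin n → ℝ) 
    (hr : ∀ i, r i < 0) (h2 : ∑ i, r i • x i ∈ posHull A) : posHull A = Set.univ := by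
  classical
  rw [Set.eq_univ_iff_forall]
  intro w
  have hw : w ∈ Submodule.span ℝ (Set.range x) := by rw [hx]; trivial
  obtain ⟨g, rfl⟩ := (Submodule.mem_span_range_iff_exists_fun ℝ).1 hw
  let M : ℝ := ∑ i, |g i / r i|
  have hM0 : 0 ≤ M := Finset.sum_nonneg fun i _ => abs_nonneg _
  have hM : ∀ i, 0 ≤ g i - M * r i := by
    intro i
    have h : |g i / r i| ≤ M := Finset.single_le_sum (f := fun i => |g i / r i|) (fun i _ => abs_nonneg _) (Finset.mem_univ i)
    have h' := (le_abs_self _).trans h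
    rw [div_le_iff_of_neg (hr i)] at h'
    linarith
  have : ∑ i, g i • x i = M • (∑ i, r i • x i) + ∑ i, (g i - M * r i) • x i := by
    rw [Finset.smul_sum, ← Finset.sum_add_distrib]
    refine Finset.sum_congr rfl fun i _ => ?_
    module
  rw [this]
  exact ph_add (ph_smul hM0 h2) (ph_sum _ _ fun i _ => ph_smul (hM i) (h1 i))

lemma ne_of_ph {n : ℕ} {A : Set (EuclideanSpace ℝ (Fin n))} (i : Fin n) (h : posHull A = Set.univ) :
    A.Nonempty := by
  by_contra hA
  rw [Set.not_nonempty_iff_eq_empty] at hA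
  have h1 := ph_span h
  rw [hA, Submodule.span_empty] at h1
  have h2 : Module.finrank ℝ (⊥ : Submodule ℝ (EuclideanSpace ℝ (Fin n))) = n := by
    rw [h1, finrank_top]; simp
  rw [finrank_bot] at h2
  have := i.2
  omega

/-- Colourful Steinitz theorem. -/
lemma steinitz {n : ℕ} (Y : Fin n ⊕ Fin n → Set (EuclideanSpace ℝ (Fin n)))
    (hY : ∀ i, posHull (Y i) = Set.univ) :
    ∃ y : Fin n ⊕ Fin n → EuclideanSpace ℝ (Fin n), (∀ i, y i ∈ Y i) ∧ posHull (Set.range y) = Set.univ := by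
  obtain ⟨x, hx, hli⟩ := greedy le_rfl (fun i => Y (Sum.inl i)) (fun i => hY _)
  obtain ⟨z, c, hz, hc, hzc⟩ := CC (fun i => Y (Sum.inr i)) (∑ i, (-1 : ℝ) • x i)
    (fun i => ne_of_ph i (hY _)) (fun i => by rw [hY]; trivial)
  refine ⟨Sum.elim x z, ?_, ?_⟩
  · rintro (i | i)
    · exact hx i
    · exact hz i
  · refine ph_univ_of_basis x (hli.span_eq_top_of_card_eq_finrank' (by simp)) 
      (fun i => ph_mem ⟨Sum.inl i, rfl⟩) (fun _ => -1) (by simp) ?_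
    rw [hzc]
    exact ph_sum _ _ fun i _ => ph_smul (hc i) (ph_mem ⟨Sum.inr i, rfl⟩)

end CS
namespace CS

/-- The standing assumptions. -/
structure Hyp {d : ℕ} (X : Fin (2 * d) → Set (EuclideanSpace ℝ (Fin d))) : Prop where
  hXs : ∀ i, X i ⊆ Metric.sphere (0 : EuclideanSpace ℝ (Fin d)) 1
  hX : ∀ i, posHull (X i) = Set.univ
  hno : ∀ I : Finset (Fin (2 * d)), I ≠ Finset.univ →
      ∀ x : Fin (2 * d) → EuclideanSpace ℝ (Fin d),
        (∀ i ∈ I, x i ∈ X i) → posHull (x '' ↑I) ≠ Set.univ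

/-- `x` is a basis with dual basis `φ`, chosen from the colour classes given by `a`. -/
structure BT {d : ℕ} (X : Fin (2 * d) → Set (EuclideanSpace ℝ (Fin d))) (a : Fin d → Fin (2 * d))
    (x : Fin d → EuclideanSpace ℝ (Fin d)) (φ : Fin d → EuclideanSpace ℝ (Fin d) →ₗ[ℝ] ℝ) : Prop where
  inj : Function.Injective a
  mem : ∀ k, x k ∈ X (a k)
  dual : ∀ m k, φ m (x k) = if m = k then 1 else 0

lemma exists_dual {d : ℕ} {x : Fin d → EuclideanSpace ℝ (Fin d)} (h : LinearIndependent ℝ x) :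
    ∃ φ : Fin d → EuclideanSpace ℝ (Fin d) →ₗ[ℝ] ℝ, ∀ m k, φ m (x k) = if m = k then 1 else 0 := by
  classical
  let B := Module.Basis.mk h (h.span_eq_top_of_card_eq_finrank' (by simp)).ge
  refine ⟨fun m => B.coord m, fun m k => ?_⟩
  have : x k = B k := by simp [B]
  rw [this, Module.Basis.coord_apply, Module.Basis.repr_self, Finsupp.single_apply]
  simp only [eq_comm]

lemma dual_li {d : ℕ} {x : Fin d → EuclideanSpace ℝ (Fin d)} {φ : Fin d → EuclideanSpace ℝ (Fin d) →ₗ[ℝ] ℝ}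
    (h : ∀ m k, φ m (x k) = if m = k then 1 else 0) : LinearIndependent ℝ x := by
  rw [Fintype.linearIndependent_iff]
  intro g hg i
  have := congrArg (φ i) hg
  simpa [map_sum, h] using this

lemma dual_span {d : ℕ} {x : Fin d → EuclideanSpace ℝ (Fin d)} {φ : Fin d → EuclideanSpace ℝ (Fin d) →ₗ[ℝ] ℝ}
    (h : ∀ m k, φ m (x k) = if m = k then 1 else 0) : Submodule.span ℝ (Set.range x) = ⊤ :=
  (dual_li h).span_eq_top_of_card_eq_finrank' (by simp)

lemma dual_expand {d : ℕ} {x : Fin d → EuclideanSpace ℝ (Fin d)} {φ : Fin d → EuclideanSpace ℝ (Fin d) →ₗ[ℝ] ℝ}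
    (h : ∀ m k, φ m (x k) = if m = k then 1 else 0) (v : EuclideanSpace ℝ (Fin d)) :
    v = ∑ k, φ k v • x k := by
  have hv : v ∈ Submodule.span ℝ (Set.range x) := by rw [dual_span h]; trivial
  obtain ⟨g, rfl⟩ := (Submodule.mem_span_range_iff_exists_fun ℝ).1 hv
  refine Finset.sum_congr rfl fun k _ => ?_
  congr 1
  simp [map_sum, h]

lemma Hyp.norm {d : ℕ} {X : Fin (2 * d) → Set (EuclideanSpace ℝ (Fin d))} (H : Hyp X) {j} {z} (hz : z ∈ X j) :
    ‖z‖ = 1 := by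
  simpa using H.hXs j hz

/-- Two unit vectors, positive multiples of each other, agree. -/
lemma unit_eq {d : ℕ} {z w : EuclideanSpace ℝ (Fin d)} (hz : ‖z‖ = 1) (hw : ‖w‖ = 1) {r : ℝ} (hr : 0 ≤ r)
    (h : z = r • w) : z = w := by
  have : r = 1 := by
    have h1 := congrArg norm h
    rw [norm_smul, hz, hw, mul_one, Real.norm_eq_abs, abs_of_nonneg hr] at h1
    exact h1.symm
  rw [h, this, one_smul]

lemma unit_eq_neg {d : ℕ} {z w : EuclideanSpace ℝ (Fin d)} (hz : ‖z‖ = 1) (hw : ‖w‖ = 1) {r : ℝ} (hr : r ≤ 0)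
    (h : z = r • w) : z = -w :=
  unit_eq (r := -r) hz (by rwa [norm_neg]) (by linarith) (by rw [h]; module)

lemma NS {d : ℕ} {X : Fin (2 * d) → Set (EuclideanSpace ℝ (Fin d))} (H : Hyp X) {a x φ} (h : BT X a x φ)
    {b : Fin d → Fin (2 * d)} (hb : Function.Injective b) (hab : ∀ k l, a k ≠ b l)
    (y : Fin d → EuclideanSpace ℝ (Fin d)) (hy : ∀ k, y k ∈ X (b k)) (c : Fin d → ℝ) (hc : ∀ k, 0 ≤ c k)
    (k0 : Fin d) (hk0 : c k0 = 0) (hneg : ∀ m, φ m (∑ k, c k • y k) < 0) : False := by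
  classical
  let I : Finset (Fin (2 * d)) := Finset.univ.image a ∪ (Finset.univ.erase k0).image b
  have hbk : b k0 ∉ I := by
    simp only [I, Finset.mem_union, Finset.mem_image, Finset.mem_univ, true_and, Finset.mem_erase, not_or]
    refine ⟨fun ⟨k, hk⟩ => hab k k0 hk, fun ⟨l, hl, hl'⟩ => hl.1 (hb hl')⟩
  let f : Fin (2 * d) → EuclideanSpace ℝ (Fin d) := Function.extend a x (Function.extend b y 0)
  have hfa : ∀ k, f (a k) = x k := fun k => h.inj.extend_apply _ _ _
  have hfb : ∀ l, f (b l) = y l := by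
    intro l
    rw [show f (b l) = Function.extend b y 0 (b l) from
      Function.extend_apply' _ _ _ (fun ⟨k, hk⟩ => hab k l hk)]
    exact hb.extend_apply _ _ _
  refine H.hno I (fun hI => hbk (hI ▸ Finset.mem_univ _)) f ?_ ?_
  · intro i hi
    simp only [I, Finset.mem_union, Finset.mem_image, Finset.mem_univ, true_and, Finset.mem_erase] at hi
    rcases hi with ⟨k, rfl⟩ | ⟨l, hl, rfl⟩
    · rw [hfa]; exact h.mem k
    · rw [hfb]; exact hy l
  · refine ph_univ_of_basis x (dual_span h.dual) (fun k => ph_mem ⟨a k, by simp [I], hfa k⟩)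
      (fun m => φ m (∑ k, c k • y k)) hneg ?_
    rw [← dual_expand h.dual]
    refine ph_sum _ _ fun k _ => ?_
    by_cases hk : k = k0
    · rw [hk, hk0, zero_smul]; exact ph_zero _
    · exact ph_smul (hc k) (ph_mem ⟨b k, by simp [I]; right; exact ⟨k, hk, rfl⟩, hfb k⟩)

lemma partA {d : ℕ} {X : Fin (2 * d) → Set (EuclideanSpace ℝ (Fin d))} (H : Hyp X) {a x φ} (h : BT X a x φ) :
    ∃ b, BT X b (fun k => - x k) (fun k => - φ k) ∧ ∀ k l, a k ≠ b l := by
  classical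
  have hcard : (Finset.univ \ Finset.univ.image a).card = d := by
    rw [Finset.card_univ_sdiff, Finset.card_image_of_injective _ h.inj]
    simp
    omega
  let b : Fin d → Fin (2 * d) := Finset.orderEmbOfFin _ hcard
  have hb : Function.Injective b := (Finset.orderEmbOfFin _ hcard).injective
  have hab : ∀ k l, a k ≠ b l := by
    intro k l hkl
    have := Finset.orderEmbOfFin_mem _ hcard l
    rw [Finset.mem_sdiff] at this
    exact this.2 (Finset.mem_image.2 ⟨k, Finset.mem_univ _, hkl⟩)
  obtain ⟨y, c0, hy, hc0, hv0⟩ := CC (fun k => X (b k)) (∑ k, (-1 : ℝ) • x k)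
    (fun k => ne_of_ph k (H.hX _)) (fun k => by rw [H.hX]; trivial)
  obtain ⟨c, hc, hcs, hind⟩ := conicCar y c0 hc0
  have hv : ∑ k, (-1 : ℝ) • x k = ∑ k, c k • y k := hv0.trans hcs.symm
  have hφv : ∀ m, φ m (∑ k, c k • y k) = -1 := by
    intro m; rw [← hv]; simp [map_sum, h.dual]
  have hcpos : ∀ k, c k ≠ 0 := by
    intro k hk
    exact NS H h hb hab y hy c hc k hk fun m => by rw [hφv]; norm_num
  have hli : LinearIndependent ℝ y := by
    rw [Fintype.linearIndependent_iff]
    intro g hg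
    exact congrFun (hind g (fun i hi => absurd hi (hcpos i)) hg)
  obtain ⟨ψ, hψ⟩ := exists_dual hli
  have hbt : BT X b y ψ := ⟨hb, hy, hψ⟩
  have hψx : ∀ k i, ψ k (x i) ≤ 0 := by
    intro k i
    by_contra! hpos
    obtain ⟨s, hs, hnn, l, hl, hzero⟩ := ratio c (fun k => ψ k (x i)) hc ⟨k, hpos⟩
    refine NS H h hb hab y hy _ hnn l hzero fun m => ?_
    have : ∑ k, (c k - s * ψ k (x i)) • y k = ∑ k, c k • y k - s • x i := by
      simp only [sub_smul, mul_smul, Finset.sum_sub_distrib, ← Finset.smul_sum]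
      rw [← dual_expand hψ (x i)]
    rw [this, map_sub, hφv, map_smul, h.dual]
    split_ifs <;> simp <;> linarith
  have hρ : ∀ i, ∃ m, ∀ k, k ≠ i → ψ m (x k) = 0 := by
    intro i
    by_contra! hcon
    refine NS H hbt h.inj (fun k l => (hab l k).symm) x h.mem (fun k => if k = i then 0 else 1)
      (fun k => by split_ifs <;> simp) i (by simp) fun m => ?_
    obtain ⟨k, hk, hne⟩ := hcon m
    rw [map_sum]
    refine Finset.sum_neg' (fun l _ => ?_) ⟨k, Finset.mem_univ _, ?_⟩
    · split_ifs <;> simp [hψx]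
    · simp only [hk, if_false, one_smul]
      exact lt_of_le_of_ne (hψx m k) hne
  choose ρ hρ using hρ
  have hρne : ∀ i, ψ (ρ i) (x i) ≠ 0 := by
    intro i h0
    have h1 : ψ (ρ i) (y (ρ i)) = 1 := by rw [hψ]; simp
    rw [dual_expand h.dual (y (ρ i)), map_sum, Finset.sum_eq_zero] at h1
    · simp at h1
    · intro k _
      rw [map_smul]
      by_cases hk : k = i
      · rw [hk, h0, smul_zero]
      · rw [hρ i k hk, smul_zero]
  have hρinj : Function.Injective ρ := by
    intro i i' hii
    by_contra hne
    exact hρne i (by rw [hii]; exact hρ i' i hne)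
  have hρsurj : Function.Surjective ρ := Finite.surjective_of_injective hρinj
  have hxy : ∀ i, - x i = y (ρ i) := by
    intro i
    rw [neg_eq_iff_eq_neg]
    refine unit_eq_neg (H.norm (h.mem i)) (H.norm (hy _)) (hψx (ρ i) i) ?_
    conv_lhs => rw [dual_expand hψ (x i)]
    refine Finset.sum_eq_single _ (fun m _ hm => ?_) (by simp)
    obtain ⟨l, rfl⟩ := hρsurj m
    rw [hρ l i (fun hil => hm (by rw [hil])), zero_smul]
  refine ⟨fun i => b (ρ i), ⟨hb.comp hρinj, fun k => ?_, fun m k => ?_⟩, fun k l => hab _ _⟩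
  · simp only [hxy]; exact hy _
  · simp [h.dual]

lemma swap {d : ℕ} {X : Fin (2 * d) → Set (EuclideanSpace ℝ (Fin d))} {a x φ} (h : BT X a x φ)
    {k : Fin d} {j} {p} (hp : p ∈ X j) (hj : ∀ k', k' ≠ k → a k' ≠ j) (hpk : φ k p ≠ 0) :
    BT X (Function.update a k j) (Function.update x k p)
      (fun m => if m = k then (φ k p)⁻¹ • φ k else φ m - (φ m p / φ k p) • φ k) := by
  classical
  refine ⟨?_, ?_, ?_⟩
  · intro l l' hll
    by_cases h1 : l = k <;> by_cases h2 : l' = k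
    · rw [h1, h2]
    · subst h1; simp [h2] at hll; exact absurd hll.symm (hj _ h2)
    · subst h2; simp [h1] at hll; exact absurd hll (hj _ h1)
    · simp [h1, h2] at hll; exact h.inj hll
  · intro l
    by_cases h1 : l = k
    · subst h1; simpa using hp
    · simpa [h1] using h.mem l
  · intro m l
    by_cases h1 : l = k <;> by_cases h2 : m = k
    · simp [h1, h2, hpk]
    · simp [h1, h2, hpk]
    · have h3 : ¬ k = l := fun e => h1 e.symm
      simp [h1, h2, h3, h.dual]
    · have h3 : ¬ k = l := fun e => h1 e.symm
      simp [h1, h2, h3, h.dual]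

lemma basic0 {d : ℕ} {X : Fin (2 * d) → Set (EuclideanSpace ℝ (Fin d))} (H : Hyp X) {a x φ} (h : BT X a x φ)
    {k m : Fin d} (hmk : m ≠ k) {z} (hz : z ∈ X (a k)) (hpos : 0 < φ k z) : φ m z ≤ 0 := by
  classical
  by_contra! hm
  obtain ⟨b, hb, hab⟩ := partA H h
  let M : ℝ := ∑ l, |φ l z| + 1
  have hM : ∀ l, 0 < φ l z + M := by
    intro l
    have h1 : |φ l z| ≤ ∑ l, |φ l z| :=
      Finset.single_le_sum (f := fun l => |φ l z|) (fun i _ => abs_nonneg _) (Finset.mem_univ l)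
    have := neg_abs_le (φ l z)
    simp only [M]; linarith
  have hM0 : 0 ≤ M := by
    have : 0 ≤ ∑ l, |φ l z| := Finset.sum_nonneg fun i _ => abs_nonneg _
    simp only [M]; linarith
  refine NS H hb h.inj (fun k l => (hab l k).symm) (Function.update x k z) ?_
    (fun l => if l = k then 1 else if l = m then 0 else M) ?_ m (by simp [hmk]) ?_
  · intro l
    by_cases h1 : l = k
    · subst h1; simpa using hz
    · simpa [h1] using h.mem l
  · intro l; split_ifs <;> simp [hM0]
  · intro l
    rw [LinearMap.neg_apply, neg_lt_zero, map_sum, ← Finset.add_sum_erase _ _ (Finset.mem_univ k)]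
    have : ∀ i ∈ Finset.univ.erase k, φ l ((if i = k then (1 : ℝ) else if i = m then 0 else M) •
        Function.update x k z i) = if i = l then (if i = m then 0 else M) else 0 := by
      intro i hi
      have hik := Finset.ne_of_mem_erase hi
      simp only [hik, if_false, Function.update_of_ne hik, map_smul, h.dual]
      by_cases hil : i = l
      · simp [hil]
      · have : ¬ l = i := fun e => hil e.symm
        simp [hil, this]
    rw [Finset.sum_congr rfl this, Finset.sum_ite_eq']
    simp only [if_true, Function.update_self, one_smul, Finset.mem_erase, Finset.mem_univ, and_true]
    by_cases hlk : l = k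
    · simp [hlk, hpos]
    · by_cases hlm : l = m
      · simp [hlm, hm]
      · simp [hlk, hlm, hM]

lemma basic1 {d : ℕ} {X : Fin (2 * d) → Set (EuclideanSpace ℝ (Fin d))} (H : Hyp X) {a x φ} (h : BT X a x φ)
    {k : Fin d} {z} (hz : z ∈ X (a k)) (hpos : 0 < φ k z) : z = x k := by
  classical
  have hs := swap h hz (fun k' hk' e => hk' (h.inj e)) hpos.ne'
  have h0 : ∀ m, m ≠ k → φ m z = 0 := by
    intro m hm
    apply le_antisymm (basic0 H h hm hz hpos)
    have := basic0 H hs hm (z := x k) (by simpa using h.mem k) (by simp [h.dual, hpos])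
    simp only [hm, if_false, LinearMap.sub_apply, LinearMap.smul_apply, h.dual, if_true, smul_eq_mul,
      mul_one, zero_sub, neg_nonpos] at this
    by_contra! hneg
    have := div_neg_of_neg_of_pos hneg hpos
    linarith
  refine unit_eq (H.norm hz) (H.norm (h.mem k)) hpos.le ?_
  conv_lhs => rw [dual_expand h.dual z]
  exact Finset.sum_eq_single _ (fun m _ hm => by rw [h0 m hm, zero_smul]) (by simp)

lemma basic2 {d : ℕ} {X : Fin (2 * d) → Set (EuclideanSpace ℝ (Fin d))} (H : Hyp X) {a x φ} (h : BT X a x φ)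
    {k : Fin d} {j} (hj : ∀ k', k' ≠ k → a k' ≠ j) {z z'} (hz : z ∈ X j) (hz' : z' ∈ X j)
    (hpos : 0 < φ k z * φ k z') : z' = z := by
  classical
  have hne : φ k z ≠ 0 := fun e => by simp [e] at hpos
  have hs := swap h hz hj hne
  have := basic1 H hs (k := k) (z := z') (by simpa using hz') (by
    simp only [if_true, LinearMap.smul_apply, smul_eq_mul]
    have h2 : 0 < (φ k z)⁻¹ ^ 2 := by positivity
    have : (φ k z)⁻¹ * φ k z' = (φ k z)⁻¹ ^ 2 * (φ k z * φ k z') := by field_simp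
    rw [this]; positivity)
  simpa using this

/-- `x` with dual `φ` occurs as a transversal. -/
def Good {d : ℕ} (X : Fin (2 * d) → Set (EuclideanSpace ℝ (Fin d)))
    (x : Fin d → EuclideanSpace ℝ (Fin d)) (φ : Fin d → EuclideanSpace ℝ (Fin d) →ₗ[ℝ] ℝ) : Prop :=
  ∃ a, BT X a x φ

/-- Any two points of a class on the same side of a wall agree. -/
def Wall {d : ℕ} (X : Fin (2 * d) → Set (EuclideanSpace ℝ (Fin d))) (α : EuclideanSpace ℝ (Fin d) →ₗ[ℝ] ℝ) : Prop :=
  ∀ j, ∀ z ∈ X j, ∀ z' ∈ X j, 0 < α z * α z' → z' = z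

lemma wall {d : ℕ} {X : Fin (2 * d) → Set (EuclideanSpace ℝ (Fin d))} (H : Hyp X) {a x φ} (h : BT X a x φ)
    (k : Fin d) : Wall X (φ k) := by
  intro j z hz z' hz' hpos
  obtain ⟨b, hb, hab⟩ := partA H h
  by_cases hj : ∀ k', k' ≠ k → a k' ≠ j
  · exact basic2 H h hj hz hz' hpos
  · push Not at hj
    obtain ⟨k', _, rfl⟩ := hj
    exact basic2 H hb (k := k) (fun l _ e => hab k' l e.symm) hz hz' (by simpa using hpos)

/-- Walls of the swapped bases. -/
lemma wall_swap {d : ℕ} {X : Fin (2 * d) → Set (EuclideanSpace ℝ (Fin d))} (H : Hyp X) {a x φ} (h : BT X a x φ)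
    {k m : Fin d} (hmk : m ≠ k) {j} {p} (hp : p ∈ X j) (hpk : φ k p ≠ 0) :
    Wall X (φ m - (φ m p / φ k p) • φ k) := by
  obtain ⟨b, hb, hab⟩ := partA H h
  by_cases hj : ∀ k', k' ≠ k → a k' ≠ j
  · simpa [hmk] using wall H (swap h hp hj hpk) m
  · push Not at hj
    obtain ⟨k', _, rfl⟩ := hj
    have := wall H (swap hb hp (k := k) (fun l _ e => hab k' l e.symm) (by simpa using hpk)) m
    simp only [hmk, if_false, LinearMap.neg_apply, neg_div_neg_eq, smul_neg] at this
    intro j z hz z' hz' hpos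
    refine this j z hz z' hz' ?_
    simp only [LinearMap.sub_apply, LinearMap.neg_apply, LinearMap.smul_apply] at hpos ⊢
    nlinarith

end CS
namespace CS

lemma BT.ne_zero {d : ℕ} {X : Fin (2 * d) → Set (EuclideanSpace ℝ (Fin d))} {a x φ} (h : BT X a x φ)
    (k : Fin d) : φ k ≠ 0 := by
  intro h0
  have := h.dual k k
  simp [h0] at this

lemma ex_pos {d : ℕ} {X : Fin (2 * d) → Set (EuclideanSpace ℝ (Fin d))} (H : Hyp X) {a x φ} (h : BT X a x φ)
    (l) (k : Fin d) : ∃ z ∈ X l, 0 < φ k z := ph_univ_pos (H.hX l) _ (h.ne_zero k)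

lemma ex_neg {d : ℕ} {X : Fin (2 * d) → Set (EuclideanSpace ℝ (Fin d))} (H : Hyp X) {a x φ} (h : BT X a x φ)
    (l) (k : Fin d) : ∃ z ∈ X l, φ k z < 0 := by
  obtain ⟨z, hz, hz'⟩ := ph_univ_pos (H.hX l) (-φ k) (neg_ne_zero.2 (h.ne_zero k))
  exact ⟨z, hz, by simpa using hz'⟩

lemma ex_opp {d : ℕ} {X : Fin (2 * d) → Set (EuclideanSpace ℝ (Fin d))} (H : Hyp X) {a x φ} (h : BT X a x φ)
    (l) (k : Fin d) {r : ℝ} (hr : r ≠ 0) : ∃ z ∈ X l, φ k z * r < 0 := by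
  rcases lt_or_gt_of_ne hr with hr | hr
  · obtain ⟨z, hz, h1⟩ := ex_pos H h l k
    exact ⟨z, hz, mul_neg_of_pos_of_neg h1 hr⟩
  · obtain ⟨z, hz, h1⟩ := ex_neg H h l k
    exact ⟨z, hz, mul_neg_of_neg_of_pos h1 hr⟩

lemma Wall.opp {d : ℕ} {X : Fin (2 * d) → Set (EuclideanSpace ℝ (Fin d))} {α} (h : Wall X α) {l} {q q'}
    (hq : q ∈ X l) (hq' : q' ∈ X l) (hne : q ≠ q') (h1 : α q ≠ 0) (h2 : α q' ≠ 0) : α q * α q' < 0 := by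
  rcases lt_or_gt_of_ne (mul_ne_zero h1 h2) with h3 | h3
  · exact h3
  · exact absurd (h l q hq q' hq' h3).symm hne

lemma Wall.tri {d : ℕ} {X : Fin (2 * d) → Set (EuclideanSpace ℝ (Fin d))} {α} (h : Wall X α) {l} {q q' r}
    (hq : q ∈ X l) (hq' : q' ∈ X l) (hr : r ∈ X l) (hne : q ≠ q') (h1 : α q ≠ 0) (h2 : α q' ≠ 0)
    (h3 : α r ≠ 0) : r = q ∨ r = q' := by
  by_contra! hcon
  have e1 := h.opp hq hq' hne h1 h2
  have e2 := h.opp hr hq hcon.1 h3 h1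
  have e3 := h.opp hr hq' hcon.2 h3 h2
  have e4 : 0 < (α q * α q') * (α r * α q) := mul_pos_of_neg_of_neg e1 e2
  have e5 : (α q * α q') * (α r * α q) = α q ^ 2 * (α r * α q') := by ring
  rw [e5] at e4
  nlinarith [sq_nonneg (α q)]

lemma lemU {d : ℕ} {X : Fin (2 * d) → Set (EuclideanSpace ℝ (Fin d))} (H : Hyp X) {a x φ} (h : BT X a x φ)
    {k m : Fin d} (hkm : m ≠ k) {l} {q q'} (hq : q ∈ X l) (hq' : q' ∈ X l) 
    (h1 : φ k q ≠ 0) (h2 : φ m q ≠ 0) (h3 : φ k q' ≠ 0) (h4 : φ m q' ≠ 0) : q = q' := by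
  by_contra hne
  let δ : EuclideanSpace ℝ (Fin d) →ₗ[ℝ] ℝ := (φ k q)⁻¹ • φ k - (φ m q)⁻¹ • φ m
  have hδ : δ ≠ 0 := by
    intro h0
    have : δ (x k) = (φ k q)⁻¹ := by simp [δ, h.dual, hkm]
    rw [h0] at this
    simp at this
    exact h1 this.symm
  have hδq : δ q = 0 := by simp [δ, h1, h2]
  have key : ∀ r ∈ X l, δ r ≠ 0 → r = q' := by
    intro r hr hr0
    have hrq : r ≠ q := fun e => hr0 (e ▸ hδq)
    by_cases hk : φ k r = 0
    · have hm : φ m r ≠ 0 := fun hm => hr0 (by simp [δ, hk, hm])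
      exact ((wall H h m).tri hq hq' hr hne h2 h4 hm).resolve_left hrq
    · exact ((wall H h k).tri hq hq' hr hne h1 h3 hk).resolve_left hrq
  obtain ⟨r, hr, hr0⟩ := ph_univ_pos (H.hX l) δ hδ
  obtain ⟨r', hr', hr0'⟩ := ph_univ_pos (H.hX l) (-δ) (neg_ne_zero.2 hδ)
  rw [LinearMap.neg_apply] at hr0'
  have e1 := key r hr hr0.ne'
  have e2 := key r' hr' (by intro e; simp [e] at hr0')
  rw [e1] at hr0
  rw [e2] at hr0'
  linarith

lemma lemP {d : ℕ} {X : Fin (2 * d) → Set (EuclideanSpace ℝ (Fin d))} (H : Hyp X) {a x φ} (h : BT X a x φ)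
    {k m : Fin d} (hkm : m ≠ k) {j} {p} (hp : p ∈ X j) (h1 : φ k p ≠ 0) (h2 : φ m p ≠ 0) (l) :
    ∃ q ∈ X l, ∃ r : ℝ, r ≠ 0 ∧ φ k q = r * φ k p ∧ φ m q = r * φ m p := by
  set t := φ m p / φ k p with ht
  have ht0 : t ≠ 0 := div_ne_zero h2 h1
  have hw : Wall X (φ m - t • φ k) := wall_swap H h hkm hp h1
  have hγ : ∀ z, (φ m - t • φ k) z = φ m z - t * φ k z := fun z => by simp
  obtain ⟨q, hq, hqk, hqm⟩ : ∃ q ∈ X l, φ k q ≠ 0 ∧ φ m q ≠ 0 := by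
    by_contra! hcon
    obtain ⟨b, hb, hb0⟩ := ex_pos H h l m
    obtain ⟨z, hz, hz0⟩ := ex_opp H h l k ht0
    have hbk : φ k b = 0 := by
      by_contra hbk
      exact hb0.ne' (hcon b hb hbk)
    have hzk : φ k z ≠ 0 := fun e => by simp [e] at hz0
    have hzm : φ m z = 0 := hcon z hz hzk
    have := hw l b hb z hz (by
      rw [hγ, hγ, hbk, hzm]
      nlinarith)
    rw [this] at hzk
    exact hzk hbk
  have hq0 : φ m q - t * φ k q = 0 := by
    by_contra hγq
    obtain ⟨z, hz, hz0⟩ := ex_opp H h l k hqk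
    obtain ⟨b, hb, hb0⟩ := ex_opp H h l m hqm
    have hzk : φ k z ≠ 0 := fun e => by simp [e] at hz0
    have hbm : φ m b ≠ 0 := fun e => by simp [e] at hb0
    have hzq : z ≠ q := fun e => by rw [e] at hz0; nlinarith [mul_self_nonneg (φ k q)]
    have hbq : b ≠ q := fun e => by rw [e] at hb0; nlinarith [mul_self_nonneg (φ m q)]
    have hzm : φ m z = 0 := by
      by_contra hzm
      exact hzq (lemU H h hkm hz hq hzk hzm hqk hqm)
    have hbk : φ k b = 0 := by
      by_contra hbk
      exact hbq (lemU H h hkm hb hq hbk hbm hqk hqm)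
    rcases hw.tri hz hq hb hzq (by rw [hγ, hzm, zero_sub]; exact neg_ne_zero.2 (mul_ne_zero ht0 hzk))
      (by rw [hγ]; exact hγq) (by rw [hγ, hbk]; simpa using hbm) with e | e
    · rw [e] at hbk; exact hzk hbk
    · exact hbq e
  refine ⟨q, hq, φ k q / φ k p, div_ne_zero hqk h1, by field_simp, ?_⟩
  rw [sub_eq_zero.1 hq0, ht]
  field_simp

/-- In the class containing `x k`, the other point off the wall has all coordinates adjacent to `k`. -/
lemma lemQ {d : ℕ} {X : Fin (2 * d) → Set (EuclideanSpace ℝ (Fin d))} (H : Hyp X) {a x φ} (h : BT X a x φ)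
    {k m : Fin d} {j} {p} (hp : p ∈ X j) (h1 : φ k p ≠ 0) (h2 : φ m p ≠ 0)
    {w} (hw : w ∈ X (a k)) (hwx : w ≠ x k) (hwk : φ k w ≠ 0) : φ m w ≠ 0 := by
  by_cases hkm : m = k
  · rw [hkm]; exact hwk
  obtain ⟨q, hq, r, hr, e1, e2⟩ := lemP H h hkm hp h1 h2 (a k)
  have hqx : x k ≠ q := by
    intro e
    rw [← e, h.dual, if_neg hkm] at e2
    exact mul_ne_zero hr h2 e2.symm
  rcases (wall H h k).tri (h.mem k) hq hw hqx (by simp [h.dual]) (by rw [e1]; exact mul_ne_zero hr h1) hwk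
    with e | e
  · exact absurd e hwx
  · rw [e, e2]; exact mul_ne_zero hr h2

lemma single_of {d : ℕ} {X : Fin (2 * d) → Set (EuclideanSpace ℝ (Fin d))} {a x φ} (h : BT X a x φ)
    {k : Fin d} {z} (hz : ∀ m, m ≠ k → φ m z = 0) : z = φ k z • x k := by
  conv_lhs => rw [dual_expand h.dual z]
  exact Finset.sum_eq_single _ (fun m _ hm => by rw [hz m hm, zero_smul]) (by simp)

lemma structureLemma {d : ℕ} {X : Fin (2 * d) → Set (EuclideanSpace ℝ (Fin d))} (H : Hyp X) {a x φ} (h : BT X a x φ)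
    {k0 m0 : Fin d} (hkm : m0 ≠ k0) {j} {p} (hp : p ∈ X j) (h1 : φ k0 p ≠ 0) (h2 : φ m0 p ≠ 0) :
    ∃ u : EuclideanSpace ℝ (Fin d), ‖u‖ = 1 ∧ φ k0 u ≠ 0 ∧ φ m0 u ≠ 0 ∧ ∀ l, ∃ ε : ℝ, (ε = 1 ∨ ε = -1) ∧
      ε • u ∈ X l ∧ (∀ k, φ k u ≠ 0 → (-(ε * Real.sign (φ k u))) • x k ∈ X l) ∧
      ∀ z ∈ X l, ∀ k, φ k u ≠ 0 → φ k z ≠ 0 → z = ε • u ∨ z = (-(ε * Real.sign (φ k u))) • x k := by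
  obtain ⟨u, hu, hu0⟩ := ex_neg H h (a k0) k0
  have hux : u ≠ x k0 := by
    intro e; rw [e, h.dual] at hu0; simp at hu0; linarith
  have hadj : ∀ m, ∀ j, ∀ p ∈ X j, φ k0 p ≠ 0 → φ m p ≠ 0 → φ m u ≠ 0 := fun m j p hp e1 e2 =>
    lemQ H h hp e1 e2 hu hux hu0.ne
  have hum : φ m0 u ≠ 0 := hadj m0 j p hp h1 h2
  have huk : φ k0 u ≠ 0 := hu0.ne
  have hun := H.norm hu
  have hw : ∀ l, ∃ ε : ℝ, (ε = 1 ∨ ε = -1) ∧ ε • u ∈ X l := by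
    intro l
    obtain ⟨w, hw, r, hr, e1, e2⟩ := lemP H h hkm hu huk hum l
    have hwk : φ k0 w ≠ 0 := by rw [e1]; exact mul_ne_zero hr huk
    have hwm : φ m0 w ≠ 0 := by rw [e2]; exact mul_ne_zero hr hum
    have hall : ∀ n, φ n w = r * φ n u := by
      intro n
      by_cases hnk : n = k0
      · rw [hnk, e1]
      by_cases hnm : n = m0
      · rw [hnm, e2]
      by_cases hnu : φ n u = 0
      · rw [hnu, mul_zero]
        by_contra hnw
        exact hadj n l w hw hwk hnw hnu
      obtain ⟨q, hq, r1, hr1, q1, q2⟩ := lemP H h hnk hu huk hnu l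
      obtain ⟨s, hs, r2, hr2, s1, s2⟩ := lemP H h hnm hu hum hnu l
      have hqk : φ k0 q ≠ 0 := by rw [q1]; exact mul_ne_zero hr1 huk
      have hqn : φ n q ≠ 0 := by rw [q2]; exact mul_ne_zero hr1 hnu
      have hsm : φ m0 s ≠ 0 := by rw [s1]; exact mul_ne_zero hr2 hum
      have hsn : φ n s ≠ 0 := by rw [s2]; exact mul_ne_zero hr2 hnu
      have hnw : φ n w ≠ 0 := by
        intro hnw
        have hwq : w ≠ q := fun e => hqn (e ▸ hnw)
        have hws : w ≠ s := fun e => hsn (e ▸ hnw)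
        have hqs : q ≠ s := by
          intro e
          exact hwq (lemU H h hkm hw hq hwk hwm hqk (by rw [e]; exact hsm))
        have o1 := (wall H h k0).opp hw hq hwq hwk hqk
        have o2 := (wall H h m0).opp hw hs hws hwm hsm
        have o3 := (wall H h n).opp hq hs hqs hqn hsn
        rw [e1, q1] at o1
        rw [e2, s1] at o2
        rw [q2, s2] at o3
        have p1 : r * r1 < 0 := by nlinarith [mul_self_nonneg (φ k0 u)]
        have p2 : r * r2 < 0 := by nlinarith [mul_self_nonneg (φ m0 u)]
        have p3 : r1 * r2 < 0 := by nlinarith [mul_self_nonneg (φ n u)]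
        have p4 := mul_pos_of_neg_of_neg p1 p2
        nlinarith [mul_self_nonneg r]
      have hwq : w = q := lemU H h hnk hw hq hwk hnw hqk hqn
      have : r = r1 := by
        rw [← hwq, e1] at q1
        exact mul_right_cancel₀ huk q1
      rw [hwq, q2, this]
    have hwu : w = r • u := by
      rw [dual_expand h.dual w]
      conv_rhs => rw [dual_expand h.dual u]
      rw [Finset.smul_sum]
      refine Finset.sum_congr rfl fun k _ => ?_
      rw [hall, mul_smul]
    refine ⟨r, ?_, hwu ▸ hw⟩
    have h3 := H.norm hw
    rw [hwu, norm_smul, hun, mul_one, Real.norm_eq_abs] at h3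
    exact (abs_eq zero_le_one).1 h3
  refine ⟨u, hun, huk, hum, fun l => ?_⟩
  obtain ⟨ε, hε, hεu⟩ := hw l
  have hε0 : ε ≠ 0 := by rcases hε with e | e <;> rw [e] <;> norm_num
  have hs : ∀ k, φ k u ≠ 0 → (-(ε * Real.sign (φ k u))) • x k ∈ X l := by
    intro k hk
    obtain ⟨z, hz, hz0⟩ := ex_opp H h l k (r := φ k (ε • u)) (by simpa using ⟨hε0, hk⟩)
    have hzk : φ k z ≠ 0 := fun e => by simp [e] at hz0
    have hzm : ∀ m, m ≠ k → φ m z = 0 := by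
      intro m hm
      by_contra hmz
      obtain ⟨ε', hε', hεu'⟩ := hw (a k)
      have hε0' : ε' ≠ 0 := by rcases hε' with e | e <;> rw [e] <;> norm_num
      have hne : ε' • u ≠ x k := by
        intro e
        have g1 := congrArg (φ k0) e
        have g2 := congrArg (φ m0) e
        rw [map_smul, h.dual, smul_eq_mul] at g1 g2
        have n1 := mul_ne_zero hε0' huk
        have n2 := mul_ne_zero hε0' hum
        rw [g1] at n1
        rw [g2] at n2
        simp at n1 n2
        exact hkm (n2.trans n1.symm)
      have := lemQ H h hz hzk hmz hεu' hne (by simpa using ⟨hε0', hk⟩)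
      have hum' : φ m u ≠ 0 := by
        intro e; simp [e] at this
      have hzu := lemU H h hm hz hεu hzk hmz (by simpa using ⟨hε0, hk⟩) (by simpa using ⟨hε0, hum'⟩)
      rw [← hzu] at hz0
      nlinarith [mul_self_nonneg (φ k z)]
    have hzx := single_of h hzm
    have hn := H.norm hz
    rw [hzx, norm_smul, H.norm (h.mem k), mul_one, Real.norm_eq_abs] at hn
    have : φ k z = -(ε * Real.sign (φ k u)) := by
      rw [map_smul, smul_eq_mul] at hz0
      rcases lt_or_gt_of_ne hk with g | g
      · rw [Real.sign_of_neg g]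
        rcases hε with e | e <;> rcases (abs_eq zero_le_one).1 hn with e' | e' <;> rw [e, e'] at hz0 ⊢ <;>
          first | (exfalso; linarith) | norm_num
      · rw [Real.sign_of_pos g]
        rcases hε with e | e <;> rcases (abs_eq zero_le_one).1 hn with e' | e' <;> rw [e, e'] at hz0 ⊢ <;>
          first | (exfalso; linarith) | norm_num
    rw [← this, ← hzx]
    exact hz
  refine ⟨ε, hε, hεu, hs, fun z hz k hk hzk => ?_⟩
  refine (wall H h k).tri hεu (hs k hk) hz ?_ (by simpa using ⟨hε0, hk⟩) ?_ hzk
  · intro e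
    have g1 := congrArg (φ k) e
    rw [map_smul, map_smul, h.dual] at g1
    simp only [smul_eq_mul, if_true, mul_one] at g1
    have : φ k u = - Real.sign (φ k u) := mul_left_cancel₀ hε0 (by rw [g1]; ring)
    rcases lt_or_gt_of_ne hk with g | g
    · rw [Real.sign_of_neg g] at this; linarith
    · rw [Real.sign_of_pos g] at this; linarith
  · rw [map_smul, h.dual]
    simp only [smul_eq_mul, if_true, mul_one]
    refine neg_ne_zero.2 (mul_ne_zero hε0 ?_)
    rw [Ne, Real.sign_eq_zero_iff]
    exact hk

end CS
namespace CS

lemma ph_map {d n : ℕ} (T : EuclideanSpace ℝ (Fin d) →ₗ[ℝ] EuclideanSpace ℝ (Fin n))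
    {A : Set (EuclideanSpace ℝ (Fin d))} {w} (hw : w ∈ posHull A) : T w ∈ posHull (T '' A) := by
  obtain ⟨N, c, f, hc, hf, rfl⟩ := hw
  exact ⟨N, c, fun i => T (f i), hc, fun i => ⟨f i, hf i, rfl⟩, by simp [map_sum]⟩

lemma ph_lift {d n : ℕ} (T : EuclideanSpace ℝ (Fin d) →ₗ[ℝ] EuclideanSpace ℝ (Fin n))
    {A : Set (EuclideanSpace ℝ (Fin d))} {v} (hv : v ∈ posHull (T '' A)) : ∃ w ∈ posHull A, T w = v := by
  obtain ⟨N, c, f, hc, hf, rfl⟩ := hv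
  choose g hg hgf using hf
  exact ⟨∑ i, c i • g i, ⟨N, c, g, hc, hg, rfl⟩, by simp [map_sum, hgf]⟩

lemma count {d : ℕ} {X : Fin (2 * d) → Set (EuclideanSpace ℝ (Fin d))} (H : Hyp X) {a x φ} (h : BT X a x φ)
    (u : EuclideanSpace ℝ (Fin d)) (C : Finset (Fin d)) (hC : ∀ k, k ∈ C ↔ φ k u ≠ 0) (hC2 : 2 ≤ C.card)
    (S0 : Finset (Fin (2 * d))) (hS0u : ∀ l ∈ S0, u ∈ X l)
    (hS0x : ∀ l ∈ S0, ∀ k ∈ C, (-(Real.sign (φ k u))) • x k ∈ X l) : S0.card ≤ C.card := by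
  classical
  by_contra! hcard
  obtain ⟨S, hSS, hS⟩ := Finset.exists_subset_card_eq (show C.card + 1 ≤ S0.card from hcard)
  have hSu : ∀ l ∈ S, u ∈ X l := fun l hl => hS0u l (hSS hl)
  have hSx : ∀ l ∈ S, ∀ k ∈ C, (-(Real.sign (φ k u))) • x k ∈ X l := fun l hl => hS0x l (hSS hl)
  have hCd : C.card ≤ d := by simpa using Finset.card_le_univ C
  set n := d - C.card with hn
  have hCc : (Finset.univ \ C).card = n := by
    rw [Finset.card_univ_sdiff]; simp [hn]
  let e : Fin n → Fin d := Finset.orderEmbOfFin _ hCc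
  have he : Function.Injective e := (Finset.orderEmbOfFin _ hCc).injective
  have hesurj : ∀ k, k ∉ C → ∃ i, e i = k := by
    intro k hk
    have : k ∈ Set.range (Finset.orderEmbOfFin _ hCc) := by
      rw [Finset.range_orderEmbOfFin]; simp [hk]
    exact this
  let T : EuclideanSpace ℝ (Fin d) →ₗ[ℝ] EuclideanSpace ℝ (Fin n) :=
    (WithLp.linearEquiv 2 ℝ (Fin n → ℝ)).symm.toLinearMap ∘ₗ LinearMap.pi (fun i => φ (e i))
  have hT : ∀ w i, T w i = φ (e i) w := fun w i => rfl
  have hTsurj : ∀ v, ∃ w, T w = v := by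
    intro v
    refine ⟨∑ i, v i • x (e i), ?_⟩
    ext i
    rw [hT, map_sum]
    simp [h.dual, he.eq_iff]
  obtain ⟨ι⟩ : Nonempty (Fin n ⊕ Fin n ↪ {l // l ∉ S}) := by
    apply Function.Embedding.nonempty_of_card_le
    rw [Fintype.card_subtype_compl]
    simp [hS]
    omega
  have hι : Function.Injective fun i => (ι i : Fin (2 * d)) := Subtype.val_injective.comp ι.injective
  obtain ⟨y0, hy0, hy0u⟩ := steinitz (fun i => T '' X (ι i)) (by
    intro i
    rw [Set.eq_univ_iff_forall]
    intro v
    obtain ⟨w, rfl⟩ := hTsurj v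
    exact ph_map T (by rw [H.hX]; trivial))
  choose y hy hTy using hy0
  obtain ⟨η⟩ : Nonempty ({l // l ∈ S} ≃ Option {k // k ∈ C}) := by
    apply Fintype.card_eq.1
    simp [hS]
  let pt : Option {k // k ∈ C} → EuclideanSpace ℝ (Fin d) :=
    fun o => o.elim u (fun k => (-(Real.sign (φ k.1 u))) • x k.1)
  let f : Fin (2 * d) → EuclideanSpace ℝ (Fin d) := fun l =>
    if hl : l ∈ S then pt (η ⟨l, hl⟩) else Function.extend (fun i => (ι i : Fin (2 * d))) y 0 l
  let I : Finset (Fin (2 * d)) := S ∪ Finset.univ.image (fun i => (ι i : Fin (2 * d)))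
  have hfι : ∀ i, f (ι i) = y i := by
    intro i
    simp only [f, (ι i).2, dif_neg, not_false_eq_true]
    exact hι.extend_apply _ _ _
  have hfS : ∀ l (hl : l ∈ S), f l = pt (η ⟨l, hl⟩) := fun l hl => by simp [f, hl]
  have hIcard : I.card < 2 * d := by
    calc I.card ≤ S.card + (Finset.univ.image (fun i => (ι i : Fin (2 * d)))).card := Finset.card_union_le _ _
      _ ≤ S.card + (n + n) := by
        gcongr
        refine Finset.card_image_le.trans ?_
        simp
      _ < 2 * d := by rw [hS]; omega
  refine H.hno I (fun hI => by rw [hI] at hIcard; simp at hIcard) f ?_ ?_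
  · intro l hl
    by_cases hlS : l ∈ S
    · rw [hfS l hlS]
      cases hη : η ⟨l, hlS⟩ with
      | none => exact hSu l hlS
      | some k => exact hSx l hlS k.1 k.2
    · simp only [I, Finset.mem_union, hlS, false_or, Finset.mem_image, Finset.mem_univ, true_and] at hl
      obtain ⟨i, rfl⟩ := hl
      rw [hfι]; exact hy i
  set A := f '' (I : Set (Fin (2 * d))) with hA
  have hpt : ∀ o, pt o ∈ posHull A := by
    intro o
    apply ph_mem
    refine ⟨(η.symm o).1, by simp [I], ?_⟩
    rw [hfS _ (η.symm o).2]
    simp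
  have hAu : u ∈ posHull A := hpt none
  have hAx : ∀ k ∈ C, (-(Real.sign (φ k u))) • x k ∈ posHull A := fun k hk => hpt (some ⟨k, hk⟩)
  have hAy : ∀ w ∈ posHull (Set.range y), w ∈ posHull A := by
    rintro w ⟨N, c, g, hc, hg, rfl⟩
    refine ph_sum _ _ fun i _ => ph_smul (hc i) (ph_mem ?_)
    obtain ⟨j, hj⟩ := hg i
    exact ⟨ι j, by simp [I], by rw [hfι, hj]⟩
  rw [Set.eq_univ_iff_forall]
  intro w
  have hTw : T w ∈ posHull (T '' Set.range y) := by
    have : T '' Set.range y = Set.range y0 := by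
      rw [← Set.range_comp]; congr 1; funext i; exact hTy i
    rw [this, hy0u]; trivial
  obtain ⟨w1, hw1, hTw1⟩ := ph_lift T hTw
  have hg0 : ∀ k, k ∉ C → φ k (w - w1) = 0 := by
    intro k hk
    obtain ⟨i, rfl⟩ := hesurj k hk
    rw [map_sub, ← hT, ← hT, hTw1, sub_self]
  set g : Fin d → ℝ := fun k => φ k (w - w1) with hg
  let M : ℝ := ∑ k, |g k / φ k u|
  have hM0 : 0 ≤ M := Finset.sum_nonneg fun i _ => abs_nonneg _
  have hMk : ∀ k, |g k / φ k u| ≤ M := fun k =>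
    Finset.single_le_sum (f := fun k => |g k / φ k u|) (fun i _ => abs_nonneg _) (Finset.mem_univ k)
  have hdec : w = w1 + (M • u + ∑ k, (g k - M * φ k u) • x k) := by
    have e1 := dual_expand h.dual (w - w1)
    have e2 := dual_expand h.dual u
    simp only [sub_smul, mul_smul, Finset.sum_sub_distrib, ← Finset.smul_sum]
    rw [← e2, ← e1]
    abel
  rw [hdec]
  refine ph_add (hAy _ hw1) (ph_add (ph_smul hM0 hAu) (ph_sum _ _ fun k _ => ?_))
  by_cases hk : k ∈ C
  · have hku := (hC k).1 hk
    have hle := hMk k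
    rw [abs_div, div_le_iff₀ (abs_pos.2 hku)] at hle
    have hsgn : (g k - M * φ k u) • x k =
        (M * |φ k u| - Real.sign (φ k u) * g k) • ((-(Real.sign (φ k u))) • x k) := by
      rw [smul_smul]
      congr 1
      rcases lt_or_gt_of_ne hku with g | g
      · rw [Real.sign_of_neg g, abs_of_neg g]; ring
      · rw [Real.sign_of_pos g, abs_of_pos g]; ring
    rw [hsgn]
    refine ph_smul ?_ (hAx k hk)
    have h1 := neg_abs_le (g k)
    have h2 := le_abs_self (g k)
    rcases lt_or_gt_of_ne hku with g | g
    · rw [Real.sign_of_neg g]; linarith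
    · rw [Real.sign_of_pos g]; linarith
  · have hku : φ k u = 0 := by
      by_contra hku; exact hk ((hC k).2 hku)
    have : g k = 0 := hg0 k hk
    rw [this, hku]
    simpa using ph_zero A

end CS

theorem main_characterization (d : ℕ)
    (X : Fin (2 * d) → Set (EuclideanSpace ℝ (Fin d)))
    (hXs : ∀ i, X i ⊆ Metric.sphere (0 : EuclideanSpace ℝ (Fin d)) 1)
    (hX : ∀ i, posHull (X i) = Set.univ)
    (hno : ∀ I : Finset (Fin (2 * d)), I ≠ Finset.univ →
      ∀ x : Fin (2 * d) → EuclideanSpace ℝ (Fin d),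
        (∀ i ∈ I, x i ∈ X i) → posHull (x '' ↑I) ≠ Set.univ) :
    (∃ e : Fin d → EuclideanSpace ℝ (Fin d),
        LinearIndependent ℝ e ∧ Submodule.span ℝ (Set.range e) = ⊤ ∧
        (∀ i, ‖e i‖ = 1) ∧
        ∀ j, X j = Set.range e ∪ (-(Set.range e))) ∨
    (∃ F : Set (EuclideanSpace ℝ (Fin d)),
        F ⊆ Metric.sphere (0 : EuclideanSpace ℝ (Fin d)) 1 ∧
        F.ncard = d + 1 ∧ posHull F = Set.univ ∧
        (∀ f ∈ F, posHull (F \ {f}) ≠ Set.univ) ∧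
        ∃ σ : Equiv.Perm (Fin (2 * d)),
          ∀ i : Fin (2 * d), X (σ i) = if (i : ℕ) < d then F else -F) := by
  classical
  have H : CS.Hyp X := ⟨hXs, hX, hno⟩
  obtain ⟨x, hx, hli⟩ := CS.greedy le_rfl (fun i : Fin d => X (Fin.castLE (by omega) i)) (fun i => hX _)
  obtain ⟨φ, hφ⟩ := CS.exists_dual hli
  have h : CS.BT X (Fin.castLE (by omega)) x φ := ⟨Fin.castLE_injective _, hx, hφ⟩
  have hxn : ∀ k, ‖x k‖ = 1 := fun k => H.norm (h.mem k)
  have hnz : ∀ j, ∀ z ∈ X j, ∃ k, φ k z ≠ 0 := by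
    intro j z hz
    by_contra! hcon
    have h1 := H.norm hz
    rw [CS.dual_expand hφ z] at h1
    simp [hcon] at h1
  by_cases hadj : ∃ k m, m ≠ k ∧ ∃ j, ∃ p ∈ X j, φ k p ≠ 0 ∧ φ m p ≠ 0
  · right
    obtain ⟨k0, m0, hkm, j, p, hp, h1, h2⟩ := hadj
    obtain ⟨u, hun, huk, hum, hl⟩ := CS.structureLemma H h hkm hp h1 h2
    choose ε hε hεu hεx hεz using hl
    let C : Finset (Fin d) := Finset.univ.filter fun k => φ k u ≠ 0
    have hC : ∀ k, k ∈ C ↔ φ k u ≠ 0 := fun k => by simp [C]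
    have hC2 : 2 ≤ C.card := by
      have : ({k0, m0} : Finset (Fin d)) ⊆ C := by
        intro k hk
        simp only [Finset.mem_insert, Finset.mem_singleton] at hk
        rcases hk with rfl | rfl
        · exact (hC _).2 huk
        · exact (hC _).2 hum
      calc 2 = ({k0, m0} : Finset (Fin d)).card := (Finset.card_pair hkm.symm).symm
        _ ≤ _ := Finset.card_le_card this
    let S : Finset (Fin (2 * d)) := Finset.univ.filter fun l => ε l = 1
    have hS1 : S.card ≤ C.card := by
      refine CS.count H h u C hC hC2 S (fun l hl => ?_) (fun l hl k hk => ?_)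
      · have e : ε l = 1 := by simpa [S] using hl
        simpa [e] using hεu l
      · have e : ε l = 1 := by simpa [S] using hl
        simpa [e] using hεx l k ((hC k).1 hk)
    have hneg : ∀ l, l ∉ S → ε l = -1 := by
      intro l hl
      have e : ε l ≠ 1 := by simpa [S] using hl
      exact (hε l).resolve_left e
    have hS2 : (Finset.univ \ S).card ≤ C.card := by
      refine CS.count H h (-u) C (fun k => by rw [hC]; simp) hC2 _ (fun l hl => ?_) (fun l hl k hk => ?_)
      · have e := hneg l (by simpa using hl)
        simpa [e] using hεu l
      · have e := hneg l (by simpa using hl)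
        have := hεx l k ((hC k).1 hk)
        rw [e] at this
        rw [map_neg, Real.sign_neg]
        simpa using this
    have hCd : C.card ≤ d := by simpa using Finset.card_le_univ C
    have hScard : S.card ≤ 2 * d := by simpa using Finset.card_le_univ S
    rw [Finset.card_univ_sdiff, Fintype.card_fin] at hS2
    have hSd : S.card = d := by omega
    have hCd' : C.card = d := by omega
    have hu : ∀ k, φ k u ≠ 0 := by
      intro k
      have : C = Finset.univ := Finset.eq_univ_of_card _ (by simpa using hCd')
      rw [← hC, this]; simp
    have hd : 2 ≤ d := by omega
    let s : Fin d → ℝ := fun k => Real.sign (φ k u)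
    have hs0 : ∀ k, s k ≠ 0 := by
      intro k; simp only [s, Ne, Real.sign_eq_zero_iff]; exact hu k
    let v : Fin d → EuclideanSpace ℝ (Fin d) := fun k => (-(s k)) • x k
    let F : Set (EuclideanSpace ℝ (Fin d)) := insert u (Set.range v)
    have hXF : ∀ l, X l = if l ∈ S then F else -F := by
      intro l
      have hmem : ∀ z, z ∈ X l ↔ z = ε l • u ∨ ∃ k, z = ε l • v k := by
        intro z
        have hv : ∀ k, ε l • v k = (-(ε l * Real.sign (φ k u))) • x k := by
          intro k; simp only [v, s]; module
        constructor
        · intro hz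
          obtain ⟨k, hk⟩ := hnz l z hz
          rcases hεz l z hz k (hu k) hk with e | e
          · exact Or.inl e
          · exact Or.inr ⟨k, by rw [hv]; exact e⟩
        · rintro (rfl | ⟨k, rfl⟩)
          · exact hεu l
          · rw [hv]; exact hεx l k (hu k)
      ext z
      rw [hmem]
      split_ifs with hlS
      · have e : ε l = 1 := by simpa [S] using hlS
        simp [e, F, eq_comm]
      · rw [hneg l hlS]
        simp only [F, Set.mem_neg, Set.mem_insert_iff, Set.mem_range, neg_smul, one_smul]
        constructor
        · rintro (rfl | ⟨k, rfl⟩)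
          · left; simp
          · right; exact ⟨k, by simp⟩
        · rintro (e | ⟨k, e⟩)
          · left; rw [← e]; simp
          · right; exact ⟨k, by rw [e]; simp⟩
    obtain ⟨l0, hl0⟩ : S.Nonempty := by rw [← Finset.card_pos]; omega
    have hXl0 : X l0 = F := by rw [hXF, if_pos hl0]
    refine ⟨F, hXl0 ▸ hXs l0, ?_, hXl0 ▸ hX l0, ?_, ?_⟩
    · have hvinj : Function.Injective v := by
        intro k k' hkk
        by_contra hne
        have := congrArg (φ k) hkk
        simp [v, hφ, hne] at this
        exact hs0 k this
      have hunot : u ∉ Set.range v := by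
        rintro ⟨k, hk⟩
        obtain ⟨m, hm⟩ : ∃ m, m ≠ k := by
          by_cases hk0 : k = k0
          · exact ⟨m0, hk0 ▸ hkm⟩
          · exact ⟨k0, fun e => hk0 e.symm⟩
        apply hu m
        rw [← hk]
        simp [v, hφ, hm]
      rw [Set.ncard_insert_of_notMem hunot (Set.finite_range v), ← Set.image_univ,
        Set.ncard_image_of_injective _ hvinj]
      simp [Set.ncard_univ]
    · intro f hf hcon
      rw [← hXl0] at hf hcon
      obtain ⟨k, hk⟩ := hnz l0 f hf
      obtain ⟨z, hz, hz0⟩ := CS.ph_univ_pos hcon (φ k f • φ k) (smul_ne_zero hk (h.ne_zero k))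
      have := CS.wall H h k l0 f hf z hz.1 (by simpa using hz0)
      exact hz.2 this
    · have hcards : Fintype.card {i : Fin (2 * d) // (i : ℕ) < d} = Fintype.card {l // l ∈ S} := by
        rw [Fintype.card_coe, hSd]
        have e : Fin d ≃ {i : Fin (2 * d) // (i : ℕ) < d} :=
          { toFun := fun i => ⟨⟨i, by omega⟩, i.2⟩
            invFun := fun i => ⟨i.1, i.2⟩
            left_inv := fun i => rfl
            right_inv := fun i => rfl }
        rw [← Fintype.card_congr e, Fintype.card_fin]
      let e := Fintype.equivOfCardEq hcards
      refine ⟨e.extendSubtype, fun i => ?_⟩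
      rw [hXF]
      by_cases hi : (i : ℕ) < d
      · rw [if_pos hi, if_pos (e.extendSubtype_mem i hi)]
      · rw [if_neg hi, if_neg (e.extendSubtype_not_mem i hi)]
  · left
    push Not at hadj
    refine ⟨x, hli, CS.dual_span hφ, hxn, fun j => ?_⟩
    have hsing : ∀ z ∈ X j, ∀ k, φ k z ≠ 0 → z = φ k z • x k := fun z hz k hk =>
      CS.single_of h fun m hm => hadj k m hm j z hz hk
    ext z
    constructor
    · intro hz
      obtain ⟨k, hk⟩ := hnz j z hz
      have e := hsing z hz k hk
      rcases le_total 0 (φ k z) with g | g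
      · exact Or.inl ⟨k, (CS.unit_eq (H.norm hz) (hxn k) g e).symm⟩
      · right
        rw [Set.mem_neg]
        exact ⟨k, by rw [CS.unit_eq_neg (H.norm hz) (hxn k) g e, neg_neg]⟩
    · rintro (⟨k, rfl⟩ | ⟨k, hk⟩)
      · obtain ⟨w, hw, hw0⟩ := CS.ex_pos H h j k
        rw [← CS.unit_eq (H.norm hw) (hxn k) hw0.le (hsing w hw k hw0.ne')]
        exact hw
      · obtain ⟨w, hw, hw0⟩ := CS.ex_neg H h j k
        have := CS.unit_eq_neg (H.norm hw) (hxn k) hw0.le (hsing w hw k hw0.ne)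
        rw [hk, neg_neg] at this
        rw [← this]; exact hw
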